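/- Every finite simple graph with m edges and arboricity at most α contains at most m·α triangles. -/

import Mathlib

open Finset SimpleGraph

/-- `G` has arboricity at most `a`: its edge set can be partitioned into `a` forests. -/
def ArboricityLE {V : Type*} (G : SimpleGraph V) (a : ℕ) : Prop :=
  ∃ F : Fin a → SimpleGraph V,
    (∀ i, F i ≤ G) ∧ (∀ i, (F i).IsAcyclic) ∧
      ∀ e ∈ G.edgeSet, ∃! i, e ∈ (F i).edgeSet

/-- The arboricity of `G`: the minimum number of forests into which the edge set of `G`
can be partitioned. -/
noncomputable def arboricity {V : Type*} (G : SimpleGraph V) : ℕ :=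
  sInf {a | ArboricityLE G a}

namespace SimpleGraph

/-- The edges of a forest can be oriented with out-degree at most one: `f` sends a vertex to
its parent. -/
theorem IsAcyclic.exists_parent {V : Type*} {H : SimpleGraph V} (hH : H.IsAcyclic) :
    ∃ f : V → V, ∀ u v, H.Adj u v → f u = v ∨ f v = u := by
  classical
  let r : V → V := fun v => (H.connectedComponentMk v).out
  have hr : ∀ v, H.Reachable v (r v) := fun v =>
    (ConnectedComponent.exact (H.connectedComponentMk v).out_eq).symm
  choose p hp using fun v => (hr v).exists_isPath
  refine ⟨fun v => (p v).snd, fun u v huv => ?_⟩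
  by_cases hv : v ∈ (p u).support
  · exact Or.inl (hH.eq_snd_of_adj_start (hp u) huv hv).symm
  · right
    have hroot : r v = r u := by
      simp only [r, ConnectedComponent.sound huv.reachable]
    have key : ∀ (w : V) (q : H.Walk v w), q.IsPath → w = r u → q.snd = u := by
      rintro w q hq rfl
      have hc : (Walk.cons huv.symm (p u)).IsPath := (hp u).cons hv
      have := congrArg Subtype.val ((hH.subsingleton_path _ _).elim ⟨q, hq⟩ ⟨_, hc⟩)
      simp only at this
      rw [this, Walk.snd_cons]
    exact key _ (p v) (hp v) hroot

theorem isAcyclic_fromEdgeSet_singleton {V : Type*} (e : Sym2 V) :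
    (fromEdgeSet {e}).IsAcyclic := by
  induction e with
  | _ u v =>
    have h : (⊥ ⊔ edge u v : SimpleGraph V).IsAcyclic :=
      isAcyclic_sup_fromEdgeSet_iff.2 ⟨isAcyclic_bot, fun h => Or.inl (reachable_bot.1 h)⟩
    rwa [bot_sup_eq] at h

end SimpleGraph

/-- The edge set of a finite graph can be partitioned into single edges. -/
theorem exists_arboricityLE {V : Type*} [Finite V] (G : SimpleGraph V) :
    ∃ a, ArboricityLE G a := by
  let φ := Finite.equivFin G.edgeSet
  refine ⟨_, fun i => fromEdgeSet {(φ.symm i).1}, fun i => ?_,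
    fun i => isAcyclic_fromEdgeSet_singleton _, fun e he => ⟨φ ⟨e, he⟩, ?_, fun i hi => ?_⟩⟩
  · rw [← edgeSet_subset_edgeSet, edgeSet_fromEdgeSet]
    rintro e ⟨rfl, -⟩
    exact (φ.symm i).2
  · simpa only [edgeSet_fromEdgeSet, Equiv.symm_apply_apply] using
      ⟨Set.mem_singleton e, G.not_isDiag_of_mem_edgeSet he⟩
  · simp only [edgeSet_fromEdgeSet] at hi
    have h : (⟨e, he⟩ : G.edgeSet) = φ.symm i := Subtype.ext hi.1
    rw [h, Equiv.apply_symm_apply]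

theorem arboricityLE_arboricity {V : Type*} [Finite V] (G : SimpleGraph V) :
    ArboricityLE G (arboricity G) :=
  Nat.sInf_mem (s := {a | ArboricityLE G a}) (exists_arboricityLE G)

/-- If the edges of `G` are covered by `a` orientations of out-degree at most one, then every
triangle contains a directed path `x → y → z`, so it is determined by the edge `s(x, y)` and the
index of an orientation in which `z` is the parent of `y`. -/
theorem card_cliqueFinset_three_le_of_parents {V : Type*} [Fintype V] [DecidableEq V]
    (G : SimpleGraph V) [DecidableRel G.Adj] {a : ℕ} (f : Fin a → V → V)
    (hf : ∀ u v, G.Adj u v → ∃ i, f i u = v ∨ f i v = u) :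
    (G.cliqueFinset 3).card ≤ G.edgeFinset.card * a := by
  have hhead : ∀ e : Sym2 V, ∃ y, e ∈ G.edgeSet → ∃ x, e = s(x, y) ∧ ∃ i, f i x = y := by
    intro e
    induction e with
    | _ u v =>
      by_cases huv : G.Adj u v
      · obtain ⟨i, h | h⟩ := hf u v huv
        · exact ⟨v, fun _ => ⟨u, rfl, i, h⟩⟩
        · exact ⟨u, fun _ => ⟨v, Sym2.eq_swap, i, h⟩⟩
      · exact ⟨u, fun h => absurd h huv⟩
  choose head hhead using hhead
  have htotal : ∀ x y, G.Adj x y → head s(x, y) = y ∨ head s(y, x) = x := by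
    intro x y hxy
    obtain ⟨w, hw, -⟩ := hhead s(x, y) hxy
    rw [Sym2.eq_swap (a := y)]
    rcases Sym2.eq_iff.1 hw with ⟨-, h⟩ | ⟨h, -⟩
    · exact Or.inl h.symm
    · exact Or.inr h.symm
  have hparent : ∀ x y, G.Adj x y → head s(x, y) = y → ∃ i, f i x = y := by
    intro x y hxy h
    obtain ⟨w, hw, i, hi⟩ := hhead s(x, y) hxy
    rw [h] at hw hi
    rw [Sym2.congr_left] at hw
    exact ⟨i, hw ▸ hi⟩
  let g : Sym2 V × Fin a → Finset V := fun q => insert (f q.2 (head q.1)) q.1.toFinset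
  have hmem : ∀ x y z, G.Adj x y → G.Adj y z → head s(x, y) = y → head s(y, z) = z →
      ({x, y, z} : Finset V) ∈ (G.edgeFinset ×ˢ univ).image g := by
    intro x y z hxy hyz hy hz
    obtain ⟨i, hi⟩ := hparent y z hyz hz
    refine mem_image.2 ⟨(s(x, y), i), by simpa using hxy, ?_⟩
    ext w
    simp only [g, hy, hi, Finset.mem_insert, Sym2.mem_toFinset, Sym2.mem_iff,
      Finset.mem_singleton]
    tauto
  have hsub : G.cliqueFinset 3 ⊆ (G.edgeFinset ×ˢ univ).image g := by
    intro t ht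
    obtain ⟨x, y, z, hxy, hxz, hyz, rfl⟩ := is3Clique_iff.1 ((mem_cliqueFinset_iff).1 ht)
    have e₁ : ({x, y, z} : Finset V) = {x, z, y} := by ext; simp; tauto
    have e₂ : ({x, y, z} : Finset V) = {y, x, z} := by ext; simp; tauto
    have e₃ : ({x, y, z} : Finset V) = {y, z, x} := by ext; simp; tauto
    have e₄ : ({x, y, z} : Finset V) = {z, x, y} := by ext; simp; tauto
    have e₅ : ({x, y, z} : Finset V) = {z, y, x} := by ext; simp; tauto
    rcases htotal x y hxy with h₁ | h₁ <;> rcases htotal y z hyz with h₂ | h₂ <;>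
      rcases htotal x z hxz with h₃ | h₃
    · exact hmem x y z hxy hyz h₁ h₂
    · exact hmem x y z hxy hyz h₁ h₂
    · exact e₁ ▸ hmem x z y hxz hyz.symm h₃ h₂
    · exact e₄ ▸ hmem z x y hxz.symm hxy h₃ h₁
    · exact e₂ ▸ hmem y x z hxy.symm hxz h₁ h₃
    · exact e₃ ▸ hmem y z x hyz hxz.symm h₂ h₃
    · exact e₅ ▸ hmem z y x hyz.symm hxy.symm h₂ h₁
    · exact e₅ ▸ hmem z y x hyz.symm hxy.symm h₂ h₁
  calc (G.cliqueFinset 3).card ≤ (G.edgeFinset ×ˢ (univ : Finset (Fin a))).card :=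
        (card_le_card hsub).trans card_image_le
    _ = G.edgeFinset.card * a := by simp [card_product]

/-- A finite simple graph with `m` edges and arboricity at most `α`
contains at most `m·α` triangles. -/
theorem triangle_count_le_of_arboricity {V : Type*} [Fintype V] [DecidableEq V]
    (G : SimpleGraph V) [DecidableRel G.Adj] (α : ℕ) (hα : arboricity G ≤ α) :
    (G.cliqueFinset 3).card ≤ G.edgeFinset.card * α := by
  obtain ⟨F, -, hacyc, hcover⟩ := arboricityLE_arboricity G
  choose f hf using fun i => (hacyc i).exists_parent
  refine (card_cliqueFinset_three_le_of_parents G f fun u v huv => ?_).trans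
    (Nat.mul_le_mul_left _ hα)
  obtain ⟨i, hi, -⟩ := hcover s(u, v) huv
  exact ⟨i, hf i u v hi⟩
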